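/- There exists a constant C* > 0, depending only on K₀, μ, α, and κ, such that |𝒢(ξ,η)|² ≤ C* (𝒢(ξ,η) : η) for all ξ, η ∈ 𝕄²ˣ²_sym. -/

import Mathlib

open Matrix Set
open scoped Classical

attribute [local instance] Matrix.frobeniusNormedAddCommGroup Matrix.frobeniusNormedSpace

noncomputable section

/-- The space of real 2×2 matrices (symmetric ones are singled out by `Matrix.IsSymm`). -/
abbrev M2 : Type := Matrix (Fin 2) (Fin 2) ℝ

/-- Frobenius inner product `A : B = tr (Aᵀ B)`. -/
def inn (A B : M2) : ℝ := (Aᵀ * B).trace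

/-- Frobenius norm `|A| = √(A : A)`. -/
def fnorm (A : M2) : ℝ := Real.sqrt (inn A A)

/-- Deviatoric part `A_D = A − (tr A / 2) Id`. -/
def dev (A : M2) : M2 := A - (A.trace / 2) • (1 : M2)

/-- The set of symmetric matrices `𝕄²ˣ²_sym`. -/
def Msym : Set M2 := {A | A.IsSymm}

/-- The Drucker–Prager elasticity set `K = {σ ∈ 𝕄²ˣ²_sym : |σ_D| + α tr σ ≤ κ}`. -/
def Kset (α κ : ℝ) : Set M2 :=
  {σ | σ.IsSymm ∧ fnorm (dev σ) + α * σ.trace ≤ κ}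

/-- The isotropic elasticity tensor `ℂ e = λ (tr e) Id + 2 μ e`. -/
def Cc (lam mu : ℝ) (e : M2) : M2 := (lam * e.trace) • (1 : M2) + (2 * mu) • e

/-- The inverse elasticity tensor `ℂ⁻¹ σ = (tr σ / (4 K₀)) Id + (1/(2μ)) σ_D`, `K₀ = λ + μ`. -/
def Cinv (lam mu : ℝ) (σ : M2) : M2 :=
  (σ.trace / (4 * (lam + mu))) • (1 : M2) + (1 / (2 * mu)) • dev σ

/-- The constant `β = (1/μ + 1/(2 α² K₀))⁻¹`. -/
def betaC (α lam mu : ℝ) : ℝ := (1 / mu + 1 / (2 * α ^ 2 * (lam + mu)))⁻¹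

/-- The function `g`. -/
def gfun (α κ lam mu : ℝ) (ξ : M2) : ℝ :=
  if 2 * mu * fnorm (dev ξ) + 2 * α * (lam + mu) * ξ.trace ≤ κ then
    ((lam + mu) / 2) * ξ.trace ^ 2 + mu * fnorm (dev ξ) ^ 2
  else
    κ * ξ.trace / (2 * α) - κ ^ 2 / (8 * α ^ 2 * (lam + mu)) +
      betaC α lam mu *
        max (fnorm (dev ξ) - ξ.trace / (2 * α) + κ / (4 * α ^ 2 * (lam + mu))) 0 ^ 2

/-- The (matrix representing the) differential of `g`. -/
def Dg (α κ lam mu : ℝ) (ξ : M2) : M2 :=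
  if 2 * mu * fnorm (dev ξ) + 2 * α * (lam + mu) * ξ.trace ≤ κ then
    ((lam + mu) * ξ.trace) • (1 : M2) + (2 * mu) • dev ξ
  else
    (κ / (2 * α)) • (1 : M2) +
      (2 * betaC α lam mu *
          max (fnorm (dev ξ) - ξ.trace / (2 * α) + κ / (4 * α ^ 2 * (lam + mu))) 0) •
        ((fnorm (dev ξ))⁻¹ • dev ξ - (1 / (2 * α)) • (1 : M2))

/-- The open cone `𝒜₁ = {ξ ∈ 𝕄²ˣ²_sym : μ |ξ_D| + α K₀ tr ξ < 0}`. -/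
def A1 (α lam mu : ℝ) : Set M2 :=
  {ξ | ξ.IsSymm ∧ mu * fnorm (dev ξ) + α * (lam + mu) * ξ.trace < 0}

/-- The open cone `𝒜₂ = {ξ ∈ 𝕄²ˣ²_sym : |ξ_D| < tr ξ / (2α)}`. -/
def A2 (α : ℝ) : Set M2 :=
  {ξ | ξ.IsSymm ∧ fnorm (dev ξ) < ξ.trace / (2 * α)}

/-- The cone `𝒜₃ = 𝕄²ˣ²_sym ∖ (cl 𝒜₁ ∪ cl 𝒜₂)`. -/
def A3 (α lam mu : ℝ) : Set M2 :=
  Msym \ (closure (A1 α lam mu) ∪ closure (A2 α))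

/-- The function `G(ξ) = Dg(ξ + (κ/(4αK₀)) Id)`, given by its explicit piecewise expression. -/
def Gfun (α κ lam mu : ℝ) (ξ : M2) : M2 :=
  if ξ ∈ A1 α lam mu then
    (κ / (2 * α)) • (1 : M2) + ((lam + mu) * ξ.trace) • (1 : M2) + (2 * mu) • dev ξ
  else if ξ ∈ A2 α ∨ ξ = 0 then
    (κ / (2 * α)) • (1 : M2)
  else
    (κ / (2 * α)) • (1 : M2) +
      (2 * betaC α lam mu * (fnorm (dev ξ) - ξ.trace / (2 * α))) •
        ((fnorm (dev ξ))⁻¹ • dev ξ - (1 / (2 * α)) • (1 : M2))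

/-- The map `𝒢(ξ, η)`. -/
def calG (α lam mu : ℝ) (ξ η : M2) : M2 :=
  if ξ ∈ A1 α lam mu then
    ((lam + mu) * η.trace) • (1 : M2) + (2 * mu) • dev η
  else if ξ ∈ A2 α ∨ ξ = 0 then
    0
  else
    (2 * betaC α lam mu * (inn (dev ξ) (dev η) / fnorm (dev ξ) - η.trace / (2 * α))) •
      ((fnorm (dev ξ))⁻¹ • dev ξ - (1 / (2 * α)) • (1 : M2)) +
    (2 * betaC α lam mu * (fnorm (dev ξ) - ξ.trace / (2 * α)) * (fnorm (dev ξ))⁻¹) •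
      (dev η - (inn (dev ξ) (dev η) / fnorm (dev ξ) ^ 2) • dev ξ)

/-- The relative boundary `∂𝒜₁` of `𝒜₁` inside `𝕄²ˣ²_sym`. -/
def bdryA1 (α lam mu : ℝ) : Set M2 := closure (A1 α lam mu) \ A1 α lam mu

/-- The relative boundary `∂𝒜₂` of `𝒜₂` inside `𝕄²ˣ²_sym`. -/
def bdryA2 (α : ℝ) : Set M2 := closure (A2 α) \ A2 α

/-- The outward normal `ν(σ) = μ σ_D/|σ_D| + α K₀ Id` for `σ ∈ ∂𝒜₁ ∖ {0}`. -/
def nu1 (α lam mu : ℝ) (σ : M2) : M2 :=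
  (mu * (fnorm (dev σ))⁻¹) • dev σ + (α * (lam + mu)) • (1 : M2)

/-- The outward normal `ν(σ) = σ_D/|σ_D| − (1/(2α)) Id` for `σ ∈ ∂𝒜₂ ∖ {0}`. -/
def nu2 (α : ℝ) (σ : M2) : M2 :=
  (fnorm (dev σ))⁻¹ • dev σ - (1 / (2 * α)) • (1 : M2)

theorem inn_eq (A B : M2) :
    inn A B = A 0 0 * B 0 0 + A 1 0 * B 1 0 + (A 0 1 * B 0 1 + A 1 1 * B 1 1) := by
  simp [inn, Matrix.trace_fin_two, Matrix.mul_apply, Fin.sum_univ_two]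

theorem inn_self_nonneg (A : M2) : 0 ≤ inn A A := by
  rw [inn_eq]
  nlinarith [mul_self_nonneg (A 0 0), mul_self_nonneg (A 1 0), mul_self_nonneg (A 0 1),
    mul_self_nonneg (A 1 1)]

theorem fnorm_sq (A : M2) : fnorm A ^ 2 = inn A A := Real.sq_sqrt (inn_self_nonneg A)

theorem fnorm_nonneg (A : M2) : 0 ≤ fnorm A := Real.sqrt_nonneg _

theorem inn_smul_left (c : ℝ) (A B : M2) : inn (c • A) B = c * inn A B := by
  simp [inn]

theorem inn_smul_right (c : ℝ) (A B : M2) : inn A (c • B) = c * inn A B := by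
  simp [inn]

theorem inn_add_left (A B C : M2) : inn (A + B) C = inn A C + inn B C := by
  simp [inn, add_mul]

theorem inn_add_right (A B C : M2) : inn A (B + C) = inn A B + inn A C := by
  simp [inn, mul_add]

theorem inn_sub_left (A B C : M2) : inn (A - B) C = inn A C - inn B C := by
  simp [inn, sub_mul]

theorem inn_sub_right (A B C : M2) : inn A (B - C) = inn A B - inn A C := by
  simp [inn, mul_sub]

theorem inn_comm (A B : M2) : inn A B = inn B A := by
  rw [inn_eq, inn_eq]; ring

theorem inn_one_left (A : M2) : inn 1 A = A.trace := by simp [inn]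

theorem inn_one_right (A : M2) : inn A 1 = A.trace := by simp [inn]

theorem trace_dev (A : M2) : (dev A).trace = 0 := by
  simp [dev, Matrix.trace_fin_two]

theorem eq_trace_smul_add_dev (A : M2) : A = (A.trace / 2) • (1 : M2) + dev A := by
  simp [dev]

theorem fnorm_eq_zero {A : M2} (h : fnorm A = 0) : A = 0 := by
  have h2 : inn A A = 0 := by rw [← fnorm_sq, h]; norm_num
  rw [inn_eq] at h2
  ext i j
  have h3 : A i j ^ 2 = 0 := by
    fin_cases i <;> fin_cases j <;> simp only [Fin.zero_eta, Fin.mk_one] <;>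
      nlinarith [mul_self_nonneg (A 0 0), mul_self_nonneg (A 1 0), mul_self_nonneg (A 0 1),
        mul_self_nonneg (A 1 1)]
  simpa using h3

/-- The quadratic form of `D` splits off its component along a unit matrix `N`. -/
theorem inn_sub_proj {N : M2} (hN : inn N N = 1) (D : M2) :
    inn (D - inn N D • N) (D - inn N D • N) = inn D D - inn N D ^ 2 := by
  simp only [inn_sub_left, inn_sub_right, inn_smul_left, inn_smul_right, hN, inn_comm D N]
  ring

theorem inn_dev_right {N : M2} (hN0 : N.trace = 0) (η : M2) : inn N η = inn N (dev η) := by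
  rw [dev, inn_sub_right, inn_smul_right, inn_one_right, hN0]
  ring

theorem inn_isotropic_add_dev (a b : ℝ) (η : M2) :
    inn (a • (1 : M2) + b • dev η) η = a * η.trace + b * inn (dev η) (dev η) := by
  rw [inn_add_left, inn_smul_left, inn_smul_left, inn_one_left,
    inn_dev_right (trace_dev η) η]

theorem inn_isotropic_add_dev_self (a b : ℝ) (η : M2) :
    inn (a • (1 : M2) + b • dev η) (a • (1 : M2) + b • dev η) =
      2 * a ^ 2 + b ^ 2 * inn (dev η) (dev η) := by
  simp only [inn_add_left, inn_add_right, inn_smul_left, inn_smul_right, inn_one_left,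
    inn_one_right, trace_dev, Matrix.trace_add, Matrix.trace_smul, Matrix.trace_one,
    Fintype.card_fin, smul_eq_mul]
  push_cast
  ring

theorem inn_plastic_self {N : M2} (hN : inn N N = 1) (hN0 : N.trace = 0) (x y k : ℝ)
    (η : M2) :
    inn (x • (N - k • (1 : M2)) + y • (dev η - inn N (dev η) • N))
        (x • (N - k • (1 : M2)) + y • (dev η - inn N (dev η) • N)) =
      x ^ 2 * (1 + 2 * k ^ 2) + y ^ 2 * (inn (dev η) (dev η) - inn N (dev η) ^ 2) := by
  simp only [inn_add_left, inn_add_right, inn_sub_left, inn_sub_right, inn_smul_left,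
    inn_smul_right, inn_one_left, inn_one_right, trace_dev, Matrix.trace_add,
    Matrix.trace_sub, Matrix.trace_smul, Matrix.trace_one, Fintype.card_fin, smul_eq_mul,
    hN, hN0, inn_comm (dev η) N]
  push_cast
  ring

theorem inn_plastic {N : M2} (hN0 : N.trace = 0) (x y k : ℝ) (η : M2) :
    inn (x • (N - k • (1 : M2)) + y • (dev η - inn N (dev η) • N)) η =
      x * (inn N (dev η) - k * η.trace) +
        y * (inn (dev η) (dev η) - inn N (dev η) ^ 2) := by
  simp only [inn_add_left, inn_sub_left, inn_smul_left, inn_one_left,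
    inn_dev_right hN0 η, inn_dev_right (trace_dev η) η]
  ring

/-- Outside `𝒜₁ ∪ 𝒜₂ ∪ {0}` the deviatoric part does not vanish. -/
theorem fnorm_dev_pos {α lam mu : ℝ} (hα : 0 < α) (hlm : 0 < lam + mu) {ξ : M2}
    (hξ : ξ.IsSymm) (h1 : ξ ∉ A1 α lam mu) (h2 : ξ ∉ A2 α) (h0 : ξ ≠ 0) :
    0 < fnorm (dev ξ) := by
  refine (fnorm_nonneg _).lt_of_ne' fun hd => h0 ?_
  have e1 : 0 ≤ mu * fnorm (dev ξ) + α * (lam + mu) * ξ.trace :=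
    not_lt.1 fun h => h1 ⟨hξ, h⟩
  have e2 : ξ.trace / (2 * α) ≤ fnorm (dev ξ) := not_lt.1 fun h => h2 ⟨hξ, h⟩
  rw [hd, mul_zero, zero_add] at e1
  rw [hd, div_le_iff₀ (by positivity), zero_mul] at e2
  have ht : ξ.trace = 0 := le_antisymm e2 (nonneg_of_mul_nonneg_right e1 (by positivity))
  rw [eq_trace_smul_add_dev ξ, fnorm_eq_zero hd, ht]
  simp

/-- There is `C* > 0` (depending only on `K₀`, `μ`, `α`, `κ`) with
`|𝒢(ξ,η)|² ≤ C* (𝒢(ξ,η) : η)` for all symmetric `ξ, η`. -/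
theorem stmt_16 (α κ lam mu : ℝ) (hα : 0 < α) (hκ : 0 < κ) (hmu : 0 < mu)
    (hlm : 0 < lam + mu) :
    ∃ Cstar : ℝ, 0 < Cstar ∧ ∀ ξ η : M2, ξ.IsSymm → η.IsSymm →
      fnorm (calG α lam mu ξ η) ^ 2 ≤ Cstar * inn (calG α lam mu ξ η) η := by
  have hβ : 0 < betaC α lam mu := by unfold betaC; positivity
  have hm : 0 < mu / (2 * α ^ 2 * (lam + mu)) := by positivity
  have hk : 0 < 2 * (1 / (2 * α)) ^ 2 := by positivity
  refine ⟨2 * (lam + mu) + 2 * mu + 2 * betaC α lam mu *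
    (1 + 2 * (1 / (2 * α)) ^ 2 + mu / (2 * α ^ 2 * (lam + mu))), by positivity, ?_⟩
  intro ξ η hξ _
  rw [fnorm_sq]
  unfold calG
  split_ifs with h1 h2
  · have hD := inn_self_nonneg (dev η)
    have ht : 0 ≤ η.trace ^ 2 := sq_nonneg _
    rw [inn_isotropic_add_dev_self, inn_isotropic_add_dev]
    calc 2 * ((lam + mu) * η.trace) ^ 2 + (2 * mu) ^ 2 * inn (dev η) (dev η)
        = (2 * (lam + mu)) * ((lam + mu) * η.trace ^ 2) +
          (2 * mu) * (2 * mu * inn (dev η) (dev η)) := by ring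
      _ ≤ (2 * (lam + mu) + 2 * mu) *
          ((lam + mu) * η.trace * η.trace + 2 * mu * inn (dev η) (dev η)) := by
        have e1 : 0 ≤ mu * ((lam + mu) * η.trace ^ 2) := by positivity
        have e2 : 0 ≤ (lam + mu) * (mu * inn (dev η) (dev η)) := by positivity
        linarith
      _ ≤ _ := by
        refine mul_le_mul_of_nonneg_right (le_add_of_nonneg_right (by positivity)) ?_
        have e1 : 0 ≤ (lam + mu) * η.trace ^ 2 := by positivity
        have e2 : 0 ≤ mu * inn (dev η) (dev η) := by positivity
        linarith
  · simp [inn]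
  · rw [not_or] at h2
    have hd := fnorm_dev_pos hα hlm hξ h1 h2.1 h2.2
    have hdd := fnorm_sq (dev ξ)
    have e1 : 0 ≤ mu * fnorm (dev ξ) + α * (lam + mu) * ξ.trace :=
      not_lt.1 fun h => h1 ⟨hξ, h⟩
    have e2 : ξ.trace / (2 * α) ≤ fnorm (dev ξ) := not_lt.1 fun h => h2.1 ⟨hξ, h⟩
    set d := fnorm (dev ξ)
    obtain ⟨N, hNdef⟩ : ∃ N : M2, N = d⁻¹ • dev ξ := ⟨_, rfl⟩
    have hN : inn N N = 1 := by
      rw [hNdef, inn_smul_left, inn_smul_right, ← hdd]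
      field_simp
    have hN0 : N.trace = 0 := by rw [hNdef, Matrix.trace_smul, trace_dev, smul_zero]
    have hs : inn (dev ξ) (dev η) / d = inn N (dev η) := by
      rw [hNdef, inn_smul_left]; ring
    have hw : (inn (dev ξ) (dev η) / d ^ 2) • dev ξ = inn N (dev η) • N := by
      rw [hNdef, inn_smul_left, smul_smul]
      congr 1
      ring
    rw [← hNdef, hs, hw, inn_plastic_self hN hN0, inn_plastic hN0]
    have hW : 0 ≤ inn (dev η) (dev η) - inn N (dev η) ^ 2 := by
      rw [← inn_sub_proj hN]; exact inn_self_nonneg _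
    have hc0 : 0 ≤ (d - ξ.trace / (2 * α)) * d⁻¹ :=
      mul_nonneg (sub_nonneg.2 e2) (inv_nonneg.2 hd.le)
    have hc1 : (d - ξ.trace / (2 * α)) * d⁻¹ ≤ 1 + mu / (2 * α ^ 2 * (lam + mu)) := by
      rw [← div_eq_mul_inv, div_le_iff₀ hd, ← sub_nonneg]
      have : (1 + mu / (2 * α ^ 2 * (lam + mu))) * d - (d - ξ.trace / (2 * α)) =
          (mu * d + α * (lam + mu) * ξ.trace) / (2 * α ^ 2 * (lam + mu)) := by
        field_simp
        ring
      rw [this]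
      positivity
    rw [mul_assoc (2 * betaC α lam mu) (d - _)]
    generalize (d - ξ.trace / (2 * α)) * d⁻¹ = c at hc0 hc1 ⊢
    generalize inn (dev η) (dev η) - inn N (dev η) ^ 2 = W at hW ⊢
    have ha : inn N (dev η) - 1 / (2 * α) * η.trace = inn N (dev η) - η.trace / (2 * α) := by
      ring
    rw [ha]
    generalize inn N (dev η) - η.trace / (2 * α) = a
    generalize 2 * (1 / (2 * α)) ^ 2 = k at hk ⊢
    generalize mu / (2 * α ^ 2 * (lam + mu)) = m at hm hc1 ⊢
    generalize betaC α lam mu = β at hβ ⊢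
    calc (2 * β * a) ^ 2 * (1 + k) + (2 * β * c) ^ 2 * W
        = 2 * β * (2 * β * a ^ 2 * (1 + k) + 2 * β * c * W * c) := by ring
      _ ≤ 2 * β * (2 * β * a ^ 2 * (1 + k + m) + 2 * β * c * W * (1 + k + m)) := by
        have e3 : 1 + k ≤ 1 + k + m := by linarith
        have e4 : c ≤ 1 + k + m := by linarith
        gcongr
      _ = 2 * β * (1 + k + m) * (2 * β * a * a + 2 * β * c * W) := by ring
      _ ≤ _ := by
        refine mul_le_mul_of_nonneg_right (le_add_of_nonneg_left (by linarith)) ?_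
        have : 2 * β * a * a = 2 * β * a ^ 2 := by ring
        rw [this]
        positivity
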